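/- For every non negative integer n, the equation 21(4x+1)² + 14(6y+1)² + 6(14z+1)² = 168n + 41 has an integer solution x, y, z. -/

import Mathlib

/-- Every integer has a translate by a multiple of `a` of absolute value at most `a / 2`. -/
lemma exists_two_mul_abs_add_mul_le (a t : ℤ) (ha : 0 < a) :
    ∃ k : ℤ, 2 * (t + k * a) ≤ a ∧ -a ≤ 2 * (t + k * a) := by
  refine ⟨-((2 * t + a) / (2 * a)), ?_⟩
  have h1 := Int.emod_add_mul_ediv (2 * t + a) (2 * a)
  have h2 := Int.emod_nonneg (2 * t + a) (show 2 * a ≠ 0 by lia)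
  have h3 := Int.emod_lt_of_pos (2 * t + a) (show 0 < 2 * a by lia)
  constructor <;> nlinarith

lemma eq_one_of_reduced (a D E g b t : ℤ) (ha : 0 < a) (hD : 0 < D) (hDE : D ≤ E) (hab : a ≤ b)
    (hb : a * b = D + t ^ 2) (hid : D * E - g ^ 2 = a) (ht1 : 2 * t ≤ a) (ht2 : -a ≤ 2 * t)
    (hg1 : 2 * g ≤ D) (hg2 : -D ≤ 2 * g) : a = 1 ∧ D = 1 := by
  have h1 : (2 * g) ^ 2 ≤ D ^ 2 := sq_le_sq' hg2 hg1
  have h2 : (2 * t) ^ 2 ≤ a ^ 2 := sq_le_sq' ht2 ht1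
  have h3 : D * D ≤ D * E := mul_le_mul_of_nonneg_left hDE hD.le
  have h4 : a * a ≤ a * b := mul_le_mul_of_nonneg_left hab ha.le
  have h5 : 3 * (D * D) ≤ 4 * a := by linarith
  have h6 : 3 * (a * a) ≤ 4 * D := by linarith
  have h7 : a ≤ 1 := by
    by_contra h
    rcases le_total a D with h8 | h8 <;> nlinarith
  have h8 : a = 1 := by lia
  subst h8
  exact ⟨rfl, by nlinarith⟩

/-- All values of a positive definite integral ternary form of determinant `1` are sums of three
squares. -/
theorem sum_three_squares_of_det_eq_one (A D : ℕ) (a b c r s t : ℤ) (hA : a.toNat = A)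
    (hD : (a * b - t ^ 2).toNat = D) (ha : 0 < a) (hΔ : 0 < a * b - t ^ 2)
    (hdet : a * b * c + 2 * r * s * t - a * r ^ 2 - b * s ^ 2 - c * t ^ 2 = 1) (x y z : ℤ) :
    ∃ u v w : ℤ, a * x ^ 2 + b * y ^ 2 + c * z ^ 2 + 2 * r * y * z + 2 * s * x * z
      + 2 * t * x * y = u ^ 2 + v ^ 2 + w ^ 2 := by
  induction A using Nat.strong_induction_on generalizing D a b c r s t x y z with
  | _ A ihA =>
  induction D using Nat.strong_induction_on generalizing a b c r s t x y z with
  | _ D ihD =>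
  have key : ∀ b c r s t : ℤ, (a * b - t ^ 2).toNat = D → 0 < a * b - t ^ 2 →
      a * b * c + 2 * r * s * t - a * r ^ 2 - b * s ^ 2 - c * t ^ 2 = 1 →
      2 * t ≤ a → -a ≤ 2 * t → 2 * s ≤ a → -a ≤ 2 * s →
      2 * (a * r - s * t) ≤ a * b - t ^ 2 → -(a * b - t ^ 2) ≤ 2 * (a * r - s * t) →
      ∀ x y z : ℤ, ∃ u v w : ℤ, a * x ^ 2 + b * y ^ 2 + c * z ^ 2 + 2 * r * y * z
        + 2 * s * x * z + 2 * t * x * y = u ^ 2 + v ^ 2 + w ^ 2 := by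
    intro b c r s t hD hΔ hdet ht1 ht2 hs1 hs2 hg1 hg2 x y z
    have hid : (a * b - t ^ 2) * (a * c - s ^ 2) - (a * r - s * t) ^ 2 = a := by
      linear_combination a * hdet
    have hpos : 0 < a * c - s ^ 2 := by
      by_contra h
      nlinarith [sq_nonneg (a * r - s * t)]
    by_cases h1 : a * c - s ^ 2 < a * b - t ^ 2
    · obtain ⟨u, v, w, h⟩ := ihD (a * c - s ^ 2).toNat (by lia) a c b r t s hA rfl ha hpos
        (by linear_combination hdet) x z y
      exact ⟨u, v, w, by rw [← h]; ring⟩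
    have hb : 0 < b := by
      by_contra h
      nlinarith [sq_nonneg t]
    by_cases h2 : b < a
    · obtain ⟨u, v, w, h⟩ := ihA b.toNat (by lia) (b * a - t ^ 2).toNat b a c s r t rfl rfl hb
        (by linarith [mul_comm a b]) (by linear_combination hdet) y x z
      exact ⟨u, v, w, by rw [← h]; ring⟩
    push Not at h1 h2
    set Δ := a * b - t ^ 2 with hΔdef
    obtain ⟨ha1, hΔ1⟩ := eq_one_of_reduced a Δ (a * c - s ^ 2) (a * r - s * t) b t ha hΔ h1 h2
      (by rw [hΔdef]; ring) hid ht1 ht2 hg1 hg2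
    clear_value Δ
    have ht : t = 0 := by lia
    have hs : s = 0 := by lia
    subst ha1 ht hs
    have hb1 : b = 1 := by linarith
    have hr : r = 0 := by lia
    subst hb1 hr
    have hc : c = 1 := by linarith
    subst hc
    exact ⟨x, y, z, by ring⟩
  obtain ⟨k, hk1, hk2⟩ := exists_two_mul_abs_add_mul_le (a * b - t ^ 2) (a * r - s * t) hΔ
  obtain ⟨j, hj1, hj2⟩ := exists_two_mul_abs_add_mul_le a t ha
  obtain ⟨l, hl1, hl2⟩ := exists_two_mul_abs_add_mul_le a (s + t * k) ha
  have hΔ' : a * (b + 2 * t * j + a * j ^ 2) - (t + j * a) ^ 2 = a * b - t ^ 2 := by ring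
  have hg : a * (r + b * k + (s + t * k) * j + (t + j * a) * l)
      - (s + t * k + l * a) * (t + j * a) = a * r - s * t + k * (a * b - t ^ 2) := by ring
  obtain ⟨u, v, w, h⟩ := key (b + 2 * t * j + a * j ^ 2)
    (c + 2 * r * k + b * k ^ 2 + 2 * (s + t * k) * l + a * l ^ 2)
    (r + b * k + (s + t * k) * j + (t + j * a) * l) (s + t * k + l * a) (t + j * a)
    (by rw [hΔ', hD]) (by rwa [hΔ']) (by linear_combination hdet) hj1 hj2 hl1 hl2
    (by rw [hg, hΔ']; exact hk1) (by rw [hg, hΔ']; exact hk2)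
    (x - j * (y - k * z) - l * z) (y - k * z) z
  exact ⟨u, v, w, by rw [← h]; ring⟩

/-- The case `m ≡ 1 (mod 8)` of Legendre's three-square theorem. -/
theorem sum_three_squares_of_mod_eight_eq_one (m : ℕ) (hm : m % 8 = 1) :
    ∃ x y z : ℤ, x ^ 2 + y ^ 2 + z ^ 2 = m := by
  obtain ⟨q, hq⟩ : ∃ q, 3 * m = 2 * q + 1 := ⟨(3 * m - 1) / 2, by lia⟩
  have hq4 : q % 4 = 1 := by lia
  have hm0 : 0 < m := by lia
  have hcop : q.Coprime (4 * m) := by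
    refine Nat.Coprime.mul_right ?_ ?_
    · exact (Nat.Coprime.pow_right 2 (Nat.coprime_two_right.2 (Nat.odd_iff.2 (by lia))) :
        q.Coprime (2 ^ 2))
    · refine Nat.Coprime.symm (Nat.coprime_of_dvd fun p hp h1 h2 => hp.one_lt.ne' ?_)
      have h3 : p ∣ 2 * q + 1 := hq ▸ h1.mul_left 3
      exact Nat.dvd_one.1 ((Nat.dvd_add_right (h2.mul_left 2)).1 h3)
  obtain ⟨p, hpgt, hp, hpq⟩ := Nat.forall_exists_prime_gt_and_modEq (3 * q)
    (by positivity : (4 * m) ≠ 0) hcop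
  obtain ⟨j, hj⟩ : ∃ j, p = q + 4 * m * j := by
    obtain ⟨j, hj⟩ := (Nat.modEq_iff_dvd' (by lia)).1 hpq.symm
    exact ⟨j, by lia⟩
  set b := 8 * j + 3 with hb
  have h2p : 2 * p + 1 = b * m := by rw [hj, hb]; linear_combination -hq
  have : Fact p.Prime := ⟨hp⟩
  have hp4 : p % 4 = 1 := by
    rw [hj, mul_assoc, Nat.add_mul_mod_self_left]; exact hq4
  have hbodd : Odd b := Nat.odd_iff.2 (by lia)
  have hpodd : Odd p := Nat.odd_iff.2 (by lia)
  have hjac : jacobiSym p b = 1 := by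
    have h1 : jacobiSym (2 * p : ℤ) b = jacobiSym (-1) b := by
      refine jacobiSym.mod_left' ?_
      refine Int.ModEq.symm (Int.modEq_iff_dvd.2 ⟨m, ?_⟩)
      have : ((2 * p + 1 : ℕ) : ℤ) = (b * m : ℕ) := by rw [h2p]
      push_cast at this
      linear_combination this
    rw [jacobiSym.mul_left, jacobiSym.at_two hbodd, jacobiSym.at_neg_one hbodd,
      ZMod.χ₈_nat_mod_eight, ZMod.χ₄_nat_mod_four, show b % 8 = 3 by lia,
      show b % 4 = 3 by lia] at h1
    have h2 : ZMod.χ₈ (3 : ℕ) = -1 := by decide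
    have h3 : ZMod.χ₄ (3 : ℕ) = -1 := by decide
    rw [h2, h3] at h1
    lia
  have hleg : legendreSym p (-b) = 1 := by
    rw [jacobiSym.legendreSym.to_jacobiSym, neg_eq_neg_one_mul, jacobiSym.mul_left,
      jacobiSym.at_neg_one hpodd, ZMod.χ₄_nat_one_mod_four hp4, one_mul,
      jacobiSym.quadratic_reciprocity_one_mod_four' hbodd hp4]
    exact hjac
  have hne : ((-b : ℤ) : ZMod p) ≠ 0 := by
    intro h
    rw [(legendreSym.eq_zero_iff p _).2 h] at hleg
    exact absurd hleg (by decide)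
  obtain ⟨s, hs⟩ : ∃ s : ℤ, (2 * p : ℤ) ∣ s ^ 2 + b := by
    obtain ⟨y, hy⟩ := (legendreSym.eq_one_iff p hne).1 hleg
    obtain ⟨s, rfl⟩ := ZMod.intCast_surjective y
    have hdvd : ∀ s' : ℤ, (s' : ZMod p) = s → (p : ℤ) ∣ s' ^ 2 + b := by
      intro s' hs'
      rw [← ZMod.intCast_zmod_eq_zero_iff_dvd]
      push_cast at hy ⊢
      rw [hs', pow_two, ← hy]; ring
    have hcop2 : IsCoprime (2 : ℤ) p := by
      exact_mod_cast Nat.isCoprime_iff_coprime.2 (Nat.coprime_two_left.2 hpodd)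
    rcases Int.even_or_odd s with h | h
    · refine ⟨s + p, hcop2.mul_dvd ?_ (hdvd _ (by simp))⟩
      have h1 : Odd (s + p) := h.add_odd (by exact_mod_cast hpodd)
      exact (h1.pow.add_odd (by exact_mod_cast hbodd)).two_dvd
    · exact ⟨s, hcop2.mul_dvd (h.pow.add_odd (by exact_mod_cast hbodd)).two_dvd (hdvd _ rfl)⟩
  obtain ⟨a, ha⟩ := hs
  have hb0 : (0 : ℤ) < b := by exact_mod_cast (by lia : 0 < b)
  have hp0 : (0 : ℤ) < p := by exact_mod_cast hp.pos
  have ha0 : 0 < a := by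
    by_contra h
    nlinarith [sq_nonneg s]
  have h2p' : (2 * p + 1 : ℤ) = b * m := by exact_mod_cast h2p
  obtain ⟨u, v, w, h⟩ := sum_three_squares_of_det_eq_one _ _ a (2 * p) m 0 1 s rfl rfl ha0
    (by linarith) (by linear_combination (-(m : ℤ)) * ha - h2p') 0 0 1
  exact ⟨u, v, w, by linear_combination -h⟩

/-- Integral vectors in three-space. -/
structure IVec where
  (x y z : ℤ)

/-- Vectors of natural numbers, used as representatives of residue classes. -/
structure NVec where
  (x y z : ℕ)

/-- Matrices of natural numbers, given by their rows. -/
structure NMat where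
  (r₁ r₂ r₃ : NVec)

namespace IVec

/-- The scalar product. -/
def dot (X Y : IVec) : ℤ := X.x * Y.x + X.y * Y.y + X.z * Y.z

/-- The vector product. -/
def cross (X Y : IVec) : IVec :=
  ⟨X.y * Y.z - X.z * Y.y, X.z * Y.x - X.x * Y.z, X.x * Y.y - X.y * Y.x⟩

/-- All coordinates are divisible by `n`. -/
abbrev DvdBy (n : ℤ) (X : IVec) : Prop := n ∣ X.x ∧ n ∣ X.y ∧ n ∣ X.z

/-- Coordinatewise division. -/
def div (X : IVec) (n : ℤ) : IVec := ⟨X.x / n, X.y / n, X.z / n⟩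

end IVec

/-- The representative of smallest absolute value of a residue modulo `1323 = 27 * 49`. -/
def centered (n : ℕ) : ℤ := if n ≤ 661 then n else n - 1323

/-- Coordinatewise centered representative. -/
def NVec.centered (u : NVec) : IVec :=
  ⟨_root_.centered u.x, _root_.centered u.y, _root_.centered u.z⟩

/-- The scalar product. -/
def NVec.dot (u v : NVec) : ℕ := u.x * v.x + u.y * v.y + u.z * v.z

/-- The action of the matrix of centered representatives. -/
def NMat.act (M : NMat) (X : IVec) : IVec :=
  ⟨M.r₁.centered.dot X, M.r₂.centered.dot X, M.r₃.centered.dot X⟩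

/-- Integral matrices `M`, congruent to the identity modulo `2`, for which `M / 3` is a rotation. -/
def rotations₃ : List NMat :=
  [⟨⟨1, 2, 2⟩, ⟨2, 1, 1321⟩, ⟨1321, 2, 1322⟩⟩,
    ⟨⟨1, 1321, 2⟩, ⟨2, 1322, 1321⟩, ⟨2, 2, 1⟩⟩,
    ⟨⟨1, 2, 1321⟩, ⟨1321, 1322, 1321⟩, ⟨1321, 2, 1⟩⟩,
    ⟨⟨1, 1321, 1321⟩, ⟨1321, 1, 1321⟩, ⟨2, 2, 1322⟩⟩]

/-- Integral matrices `M`, congruent to the identity modulo `2`, for which `M / 7` is a rotation. -/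
def rotations₇ : List NMat :=
  [⟨⟨3, 1321, 6⟩, ⟨6, 3, 1321⟩, ⟨1321, 6, 3⟩⟩,
    ⟨⟨3, 6, 2⟩, ⟨1321, 3, 1317⟩, ⟨1317, 2, 3⟩⟩,
    ⟨⟨3, 1317, 1321⟩, ⟨2, 3, 1317⟩, ⟨6, 2, 3⟩⟩,
    ⟨⟨3, 2, 1317⟩, ⟨1317, 3, 1321⟩, ⟨2, 6, 3⟩⟩,
    ⟨⟨3, 1317, 2⟩, ⟨2, 3, 6⟩, ⟨1317, 1321, 3⟩⟩,
    ⟨⟨3, 2, 6⟩, ⟨1317, 3, 2⟩, ⟨1321, 1317, 3⟩⟩,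
    ⟨⟨3, 1321, 1317⟩, ⟨6, 3, 2⟩, ⟨2, 1317, 3⟩⟩,
    ⟨⟨3, 6, 1321⟩, ⟨1321, 3, 6⟩, ⟨6, 1321, 3⟩⟩]

/-- Pairs of linear forms modulo `3` and modulo `7` that cut out a lattice isometric to the
diagonal form with coefficients `21, 14, 6`. -/
def diagonalPairs : List (NVec × NVec) :=
  [(⟨1, 1, 1⟩, ⟨1, 2, 3⟩), (⟨1, 1, 1⟩, ⟨3, 2, 1⟩), (⟨1, 1, 2⟩, ⟨1, 2, 4⟩),
    (⟨1, 1, 2⟩, ⟨3, 2, 6⟩), (⟨1, 2, 1⟩, ⟨1, 5, 3⟩), (⟨1, 2, 1⟩, ⟨3, 5, 1⟩),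
    (⟨1, 2, 2⟩, ⟨1, 5, 4⟩), (⟨1, 2, 2⟩, ⟨3, 5, 6⟩)]

/-- Vectors spanning the axes of the exceptional tori. -/
def axes : List NVec :=
  [⟨0, 1, 1321⟩, ⟨0, 1, 2⟩, ⟨2, 1322, 0⟩, ⟨2, 1, 0⟩, ⟨0, 1, 1319⟩, ⟨0, 1, 4⟩, ⟨2, 1320, 1321⟩,
    ⟨2, 1320, 2⟩, ⟨2, 3, 1321⟩, ⟨2, 3, 2⟩, ⟨4, 1322, 0⟩, ⟨4, 1, 0⟩, ⟨1, 1319, 1320⟩,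
    ⟨1, 1319, 3⟩, ⟨1, 0, 1318⟩, ⟨1, 0, 5⟩, ⟨1, 4, 1320⟩, ⟨1, 4, 3⟩, ⟨3, 1319, 1322⟩,
    ⟨3, 1319, 1⟩, ⟨3, 4, 1322⟩, ⟨3, 4, 1⟩, ⟨5, 0, 1322⟩, ⟨5, 0, 1⟩, ⟨0, 11, 1321⟩, ⟨0, 11, 2⟩,
    ⟨2, 1312, 0⟩, ⟨2, 11, 0⟩, ⟨4, 1320, 1313⟩, ⟨4, 1320, 10⟩, ⟨4, 3, 1313⟩, ⟨4, 3, 10⟩,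
    ⟨6, 1318, 1315⟩, ⟨6, 1318, 8⟩, ⟨6, 5, 1315⟩, ⟨6, 5, 8⟩, ⟨8, 1318, 1317⟩, ⟨8, 1318, 6⟩,
    ⟨8, 5, 1317⟩, ⟨8, 5, 6⟩, ⟨10, 1320, 1319⟩, ⟨10, 1320, 4⟩, ⟨10, 3, 1319⟩, ⟨10, 3, 4⟩]

/-- `k n`, arranged so that `n` is evaluated before `k` is called. -/
def evalThen (n : ℕ) (k : ℕ → Bool) : Bool :=
  match n with
  | 0 => k 0
  | m + 1 => k (m + 1)

lemma evalThen_eq (n : ℕ) (k : ℕ → Bool) : evalThen n k = k n := by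
  cases n <;> rfl

/-- Evaluates the coordinates of a vector before calling `k`. -/
def NVec.evalThen (u : NVec) (k : NVec → Bool) : Bool :=
  _root_.evalThen u.x fun x => _root_.evalThen u.y fun y => _root_.evalThen u.z fun z => k ⟨x, y, z⟩

lemma NVec.evalThen_eq (u : NVec) (k : NVec → Bool) : u.evalThen k = k u := by
  simp [NVec.evalThen, _root_.evalThen_eq]

/-- All entries of `M * u` are divisible by `p`. -/
def NMat.kills (M : NMat) (p : ℕ) (u : NVec) : Bool :=
  M.r₁.dot u % p == 0 && (M.r₂.dot u % p == 0 && M.r₃.dot u % p == 0)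

/-- Some pair in `diagonalPairs` vanishes at the residues `r` and `s`. -/
def testDiagonal (r s : NVec) : Bool :=
  diagonalPairs.any fun q => q.1.dot r % 3 == 0 && q.2.dot s % 7 == 0

/-- Some rotation with denominator `3` leads to residues that pass the test `k`. -/
def descend₃ (k : NVec → NVec → Bool) (r s : NVec) : Bool :=
  rotations₃.any fun M => M.kills 3 r &&
    NVec.evalThen ⟨M.r₁.dot r / 3, M.r₂.dot r / 3, M.r₃.dot r / 3⟩ fun r' =>
      NVec.evalThen ⟨M.r₁.dot s, M.r₂.dot s, M.r₃.dot s⟩ fun s' => k r' s'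

/-- Some rotation with denominator `7` leads to residues that pass the test `k`. -/
def descend₇ (k : NVec → NVec → Bool) (r s : NVec) : Bool :=
  rotations₇.any fun M => M.kills 7 s &&
    NVec.evalThen ⟨M.r₁.dot r, M.r₂.dot r, M.r₃.dot r⟩ fun r' =>
      NVec.evalThen ⟨M.r₁.dot s / 7, M.r₂.dot s / 7, M.r₃.dot s / 7⟩ fun s' => k r' s'

/-- Proportionality modulo `n`. -/
def NVec.proportional (n : ℕ) (u v : NVec) : Bool :=
  (u.x * v.y) % n == (u.y * v.x) % n &&
    ((u.y * v.z) % n == (u.z * v.y) % n && (u.z * v.x) % n == (u.x * v.z) % n)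

/-- The residues `r` modulo `27` and `s` modulo `49` are those of an exceptional axis. -/
def testAxes (r s : NVec) : Bool :=
  axes.any fun w => r.proportional 27 w && s.proportional 49 w

/-- Checks that all pairs of points in given affine charts are settled by one of the tests, refining
the residues where necessary. -/
def checkCharts (f g : ℕ → ℕ → NVec) (B D : ℕ) : Bool :=
  (List.range B).all fun b => (List.range 3).all fun c => (f b c).evalThen fun r =>
  !(r.dot r % 3 == 2) ||
  (List.range D).all fun d => (List.range 7).all fun e => (g d e).evalThen fun s =>
  !(s.dot s % 7 == 3 || (s.dot s % 7 == 5 || s.dot s % 7 == 6)) || (testDiagonal r s ||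
  (List.range 3).all fun b' => (List.range 3).all fun c' =>
  (f (b + 3 * b') (c + 3 * c')).evalThen fun r =>
  descend₃ testDiagonal r s ||
  (List.range 7).all fun d' => (List.range 7).all fun e' =>
  (g (d + 7 * d') (e + 7 * e')).evalThen fun s =>
  descend₇ testDiagonal r s || (descend₃ (descend₇ testDiagonal) r s ||
  (List.range 3).all fun b'' => (List.range 3).all fun c'' =>
  (f (b + 3 * b' + 9 * b'') (c + 3 * c' + 9 * c'')).evalThen fun r =>
  descend₃ (descend₃ testDiagonal) r s || (descend₃ (descend₃ (descend₇ testDiagonal)) r s ||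
  testAxes r s)))

/-- The affine chart where the first coordinate is `1`. -/
def chart₁ (b c : ℕ) : NVec := ⟨1, b, c⟩

/-- The affine chart where the second coordinate is `1`. -/
def chart₂ (b c : ℕ) : NVec := ⟨b, 1, c⟩

set_option maxRecDepth 100000

lemma checkCharts₁₁ : checkCharts chart₁ chart₁ 3 7 = true := by decide +kernel

lemma checkCharts₁₂ : checkCharts chart₁ chart₂ 3 1 = true := by decide +kernel

lemma checkCharts₂₁ : checkCharts chart₂ chart₁ 1 7 = true := by decide +kernel

lemma checkCharts₂₂ : checkCharts chart₂ chart₂ 1 1 = true := by decide +kernel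

/-- The vector `X` is proportional to `r` modulo `n`. -/
def NVec.Approx (n : ℤ) (r : NVec) (X : IVec) : Prop :=
  ∃ c : ℤ, n ∣ X.x - c * r.x ∧ n ∣ X.y - c * r.y ∧ n ∣ X.z - c * r.z

/-- The number `m` is represented by the diagonal form with coefficients `21, 14, 6`. -/
def RepDiagonal (m : ℤ) : Prop := ∃ a b c : ℤ, 21 * a ^ 2 + 14 * b ^ 2 + 6 * c ^ 2 = m

/-- Vectors of squared length `m` whose first and third coordinates have the same parity. -/
structure IVec.Admissible (m : ℤ) (X : IVec) : Prop where
  sq : X.dot X = m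
  parity : (2 : ℤ) ∣ X.x + X.z

/-- The properties of the matrices used for the descent: `M` is `p` times an orthogonal matrix and
its first and third rows add up to `(1, 0, 1)` modulo `2`. -/
structure NMat.IsScaledRotation (p : ℤ) (M : NMat) : Prop where
  col₁₁ : M.r₁.centered.x ^ 2 + M.r₂.centered.x ^ 2 + M.r₃.centered.x ^ 2 = p ^ 2
  col₂₂ : M.r₁.centered.y ^ 2 + M.r₂.centered.y ^ 2 + M.r₃.centered.y ^ 2 = p ^ 2
  col₃₃ : M.r₁.centered.z ^ 2 + M.r₂.centered.z ^ 2 + M.r₃.centered.z ^ 2 = p ^ 2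
  col₁₂ : M.r₁.centered.x * M.r₁.centered.y + M.r₂.centered.x * M.r₂.centered.y
    + M.r₃.centered.x * M.r₃.centered.y = 0
  col₁₃ : M.r₁.centered.x * M.r₁.centered.z + M.r₂.centered.x * M.r₂.centered.z
    + M.r₃.centered.x * M.r₃.centered.z = 0
  col₂₃ : M.r₁.centered.y * M.r₁.centered.z + M.r₂.centered.y * M.r₂.centered.z
    + M.r₃.centered.y * M.r₃.centered.z = 0
  par₁ : (2 : ℤ) ∣ M.r₁.centered.x + M.r₃.centered.x - 1
  par₂ : (2 : ℤ) ∣ M.r₁.centered.y + M.r₃.centered.y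
  par₃ : (2 : ℤ) ∣ M.r₁.centered.z + M.r₃.centered.z - 1

lemma isScaledRotation_three {M : NMat} (hM : M ∈ rotations₃) : M.IsScaledRotation 3 := by
  simp only [rotations₃, List.mem_cons, List.not_mem_nil, or_false] at hM
  rcases hM with rfl | rfl | rfl | rfl <;> constructor <;> decide

lemma isScaledRotation_seven {M : NMat} (hM : M ∈ rotations₇) : M.IsScaledRotation 7 := by
  simp only [rotations₇, List.mem_cons, List.not_mem_nil, or_false] at hM
  rcases hM with rfl | rfl | rfl | rfl | rfl | rfl | rfl | rfl <;> constructor <;> decide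

lemma NMat.IsScaledRotation.dot_act {p : ℤ} {M : NMat} (hM : M.IsScaledRotation p) (X : IVec) :
    (M.act X).dot (M.act X) = p ^ 2 * X.dot X := by
  simp only [NMat.act, IVec.dot]
  linear_combination X.x ^ 2 * hM.col₁₁ + X.y ^ 2 * hM.col₂₂ + X.z ^ 2 * hM.col₃₃
    + 2 * X.x * X.y * hM.col₁₂ + 2 * X.x * X.z * hM.col₁₃ + 2 * X.y * X.z * hM.col₂₃

lemma NMat.IsScaledRotation.admissible {p m : ℤ} {M : NMat} (hM : M.IsScaledRotation p)
    (hp : Odd p) {X Y : IVec} (hX : X.Admissible m) (hx : (M.act X).x = p * Y.x)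
    (hy : (M.act X).y = p * Y.y) (hz : (M.act X).z = p * Y.z) : Y.Admissible m := by
  have hp0 : p ≠ 0 := by rintro rfl; exact absurd hp (by decide)
  constructor
  · have h := hM.dot_act X
    rw [hX.sq, IVec.dot, hx, hy, hz] at h
    refine mul_left_cancel₀ (pow_ne_zero 2 hp0) ?_
    rw [← h, IVec.dot]; ring
  · obtain ⟨k, hk⟩ := hp
    obtain ⟨a, ha⟩ := hM.par₁
    obtain ⟨b, hb⟩ := hM.par₂
    obtain ⟨c, hc⟩ := hM.par₃
    obtain ⟨d, hd⟩ := hX.parity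
    simp only [NMat.act, IVec.dot] at hx hz
    refine ⟨a * X.x + b * X.y + c * X.z + d - k * (Y.x + Y.z), ?_⟩
    linear_combination -(Y.x + Y.z) * hk - hx - hz + X.x * ha + X.y * hb + X.z * hc + hd

lemma dvd_centered_sub (n : ℕ) : (1323 : ℤ) ∣ centered n - n := by
  unfold centered
  split_ifs
  · simp
  · exact ⟨-1, by ring⟩

lemma NVec.Approx.dvd_centered_dot {n : ℤ} {r : NVec} {X : IVec} {c : ℤ} (hn : n ∣ 1323)
    (hx : n ∣ X.x - c * r.x) (hy : n ∣ X.y - c * r.y) (hz : n ∣ X.z - c * r.z) (u : NVec) :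
    n ∣ u.centered.dot X - c * (u.dot r : ℕ) := by
  obtain ⟨a₁, h₁⟩ := hn.trans (dvd_centered_sub u.x)
  obtain ⟨a₂, h₂⟩ := hn.trans (dvd_centered_sub u.y)
  obtain ⟨a₃, h₃⟩ := hn.trans (dvd_centered_sub u.z)
  obtain ⟨b₁, hx⟩ := hx
  obtain ⟨b₂, hy⟩ := hy
  obtain ⟨b₃, hz⟩ := hz
  simp only [IVec.dot, NVec.dot, NVec.centered]
  push_cast
  refine ⟨a₁ * X.x + a₂ * X.y + a₃ * X.z + u.x * b₁ + u.y * b₂ + u.z * b₃, ?_⟩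
  linear_combination X.x * h₁ + X.y * h₂ + X.z * h₃ + u.x * hx + u.y * hy + u.z * hz

/-- A test is sound if admissible vectors that are proportional to residues passing the test have
a squared length represented by the diagonal form. -/
def SoundTest (m n₃ n₇ : ℤ) (k : NVec → NVec → Bool) : Prop :=
  ∀ (r s : NVec) (X : IVec), X.Admissible m → r.Approx n₃ X → s.Approx n₇ X → k r s = true →
    RepDiagonal m

lemma repDiagonal_of_dvd {m x y z : ℤ} (hm : x * x + y * y + z * z = m) (h₂ : 2 ∣ x + z)
    (h₃ : 3 ∣ x + y + z) (h₇ : 7 ∣ x + 2 * y + 3 * z) : RepDiagonal m := by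
  obtain ⟨a, ha⟩ : 21 ∣ 4 * x + y - 2 * z := by lia
  obtain ⟨b, hb⟩ : 14 ∣ x + 2 * y + 3 * z := by lia
  obtain ⟨c, hc⟩ : 6 ∣ x - 2 * y + z := by lia
  refine ⟨a, b, c, ?_⟩
  have hx : x = 4 * a + b + c := by lia
  have hy : y = a + 2 * b - 2 * c := by lia
  have hz : z = -2 * a + 3 * b + c := by lia
  rw [← hm, hx, hy, hz]; ring

lemma NVec.Approx.dvd_dot {n p : ℤ} {r : NVec} {X : IVec} (hr : r.Approx n X) (hp : p ∣ n)
    (l : NVec) (hl : p ∣ (l.dot r : ℕ)) : p ∣ l.x * X.x + l.y * X.y + l.z * X.z := by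
  obtain ⟨c, ⟨b₁, hx⟩, ⟨b₂, hy⟩, ⟨b₃, hz⟩⟩ := hr
  have h : l.x * X.x + l.y * X.y + l.z * X.z
      = c * (l.dot r : ℕ) + n * (l.x * b₁ + l.y * b₂ + l.z * b₃) := by
    simp only [NVec.dot]
    push_cast
    linear_combination l.x * hx + l.y * hy + l.z * hz
  rw [h]
  exact dvd_add (hl.mul_left c) (hp.mul_right _)

lemma soundTest_testDiagonal (m : ℤ) : SoundTest m 3 7 testDiagonal := by
  intro r s X hX hr hs h
  obtain ⟨q, hq, h⟩ := List.any_eq_true.1 h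
  simp only [Bool.and_eq_true, beq_iff_eq] at h
  have h₃ := hr.dvd_dot dvd_rfl q.1 (by exact_mod_cast Nat.dvd_of_mod_eq_zero h.1)
  have h₇ := hs.dvd_dot dvd_rfl q.2 (by exact_mod_cast Nat.dvd_of_mod_eq_zero h.2)
  have hsq := hX.sq
  have h₂ := hX.parity
  rw [IVec.dot] at hsq
  simp only [diagonalPairs, List.mem_cons, List.not_mem_nil, or_false] at hq
  rcases hq with rfl | rfl | rfl | rfl | rfl | rfl | rfl | rfl <;> push_cast at h₃ h₇
  · exact repDiagonal_of_dvd (x := X.x) (y := X.y) (z := X.z) (by linarith) (by lia) (by lia)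
      (by lia)
  · exact repDiagonal_of_dvd (x := X.z) (y := X.y) (z := X.x) (by linarith) (by lia) (by lia)
      (by lia)
  · exact repDiagonal_of_dvd (x := X.x) (y := X.y) (z := -X.z) (by linarith) (by lia) (by lia)
      (by lia)
  · exact repDiagonal_of_dvd (x := -X.z) (y := X.y) (z := X.x) (by linarith) (by lia) (by lia)
      (by lia)
  · exact repDiagonal_of_dvd (x := X.x) (y := -X.y) (z := X.z) (by linarith) (by lia) (by lia)
      (by lia)
  · exact repDiagonal_of_dvd (x := X.z) (y := -X.y) (z := X.x) (by linarith) (by lia) (by lia)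
      (by lia)
  · exact repDiagonal_of_dvd (x := X.x) (y := -X.y) (z := -X.z) (by linarith) (by lia) (by lia)
      (by lia)
  · exact repDiagonal_of_dvd (x := -X.z) (y := -X.y) (z := X.x) (by linarith) (by lia) (by lia)
      (by lia)

lemma exists_eq_mul_of_dvd {p n t c : ℤ} {v : ℕ} (h : p * n ∣ t - c * (v : ℕ))
    (q : ℕ) (hv : (v : ℤ) = p * q) : ∃ t', t = p * t' ∧ n ∣ t' - c * q := by
  obtain ⟨a, ha⟩ := h
  exact ⟨c * q + n * a, by rw [hv] at ha; linear_combination ha, by simp⟩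

lemma NMat.kills_iff {M : NMat} {p : ℕ} {u : NVec} : M.kills p u = true ↔
    M.r₁.dot u % p = 0 ∧ M.r₂.dot u % p = 0 ∧ M.r₃.dot u % p = 0 := by
  simp [NMat.kills]

lemma dvd_sub_of_mul_add_mul_eq_one {p n a b t c v : ℤ} (h : a * p + b * n = 1)
    (hv : n ∣ p * t - c * v) : n ∣ t - a * c * v := by
  obtain ⟨k, hk⟩ := hv
  exact ⟨a * k + b * t, by linear_combination a * hk - t * h⟩

lemma SoundTest.descend₃ {m n₃ n₇ : ℤ} {k : NVec → NVec → Bool} (hk : SoundTest m n₃ n₇ k)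
    (h₃ : 3 * n₃ ∣ 1323) (h₇ : n₇ ∣ 1323) (hn : IsCoprime 3 n₇) :
    SoundTest m (3 * n₃) n₇ (descend₃ k) := by
  rintro r s X hX ⟨c, hx, hy, hz⟩ ⟨d, hx', hy', hz'⟩ h
  obtain ⟨M, hM, h⟩ := List.any_eq_true.1 h
  simp only [Bool.and_eq_true, NVec.evalThen_eq, NMat.kills_iff] at h
  obtain ⟨⟨k₁, k₂, k₃⟩, h⟩ := h
  obtain ⟨a, b, hab⟩ := hn
  have e := NVec.Approx.dvd_centered_dot h₃ hx hy hz
  have e' := NVec.Approx.dvd_centered_dot h₇ hx' hy' hz'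
  obtain ⟨x, hx, ax⟩ := exists_eq_mul_of_dvd (e M.r₁) (M.r₁.dot r / 3) (by lia)
  obtain ⟨y, hy, ay⟩ := exists_eq_mul_of_dvd (e M.r₂) (M.r₂.dot r / 3) (by lia)
  obtain ⟨z, hz, az⟩ := exists_eq_mul_of_dvd (e M.r₃) (M.r₃.dot r / 3) (by lia)
  exact hk _ _ ⟨x, y, z⟩
    ((isScaledRotation_three hM).admissible (by decide) hX hx hy hz) ⟨c, ax, ay, az⟩
    ⟨a * d, dvd_sub_of_mul_add_mul_eq_one hab (hx ▸ e' M.r₁),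
      dvd_sub_of_mul_add_mul_eq_one hab (hy ▸ e' M.r₂),
      dvd_sub_of_mul_add_mul_eq_one hab (hz ▸ e' M.r₃)⟩ h

lemma SoundTest.descend₇ {m n₃ n₇ : ℤ} {k : NVec → NVec → Bool} (hk : SoundTest m n₃ n₇ k)
    (h₃ : n₃ ∣ 1323) (h₇ : 7 * n₇ ∣ 1323) (hn : IsCoprime 7 n₃) :
    SoundTest m n₃ (7 * n₇) (descend₇ k) := by
  rintro r s X hX ⟨c, hx, hy, hz⟩ ⟨d, hx', hy', hz'⟩ h
  obtain ⟨M, hM, h⟩ := List.any_eq_true.1 h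
  simp only [Bool.and_eq_true, NVec.evalThen_eq, NMat.kills_iff] at h
  obtain ⟨⟨k₁, k₂, k₃⟩, h⟩ := h
  obtain ⟨a, b, hab⟩ := hn
  have e := NVec.Approx.dvd_centered_dot h₃ hx hy hz
  have e' := NVec.Approx.dvd_centered_dot h₇ hx' hy' hz'
  obtain ⟨x, hx, ax⟩ := exists_eq_mul_of_dvd (e' M.r₁) (M.r₁.dot s / 7) (by lia)
  obtain ⟨y, hy, ay⟩ := exists_eq_mul_of_dvd (e' M.r₂) (M.r₂.dot s / 7) (by lia)
  obtain ⟨z, hz, az⟩ := exists_eq_mul_of_dvd (e' M.r₃) (M.r₃.dot s / 7) (by lia)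
  exact hk _ _ ⟨x, y, z⟩
    ((isScaledRotation_seven hM).admissible (by decide) hX hx hy hz)
    ⟨a * c, dvd_sub_of_mul_add_mul_eq_one hab (hx ▸ e M.r₁),
      dvd_sub_of_mul_add_mul_eq_one hab (hy ▸ e M.r₂),
      dvd_sub_of_mul_add_mul_eq_one hab (hz ▸ e M.r₃)⟩ ⟨d, ax, ay, az⟩ h

lemma NVec.Approx.mono {n n' : ℤ} {r : NVec} {X : IVec} (h : r.Approx n X) (hn : n' ∣ n) :
    r.Approx n' X := by
  obtain ⟨c, hx, hy, hz⟩ := h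
  exact ⟨c, hn.trans hx, hn.trans hy, hn.trans hz⟩

lemma NVec.Approx.of_congr {n : ℤ} {r r' : NVec} {X : IVec} (h : r.Approx n X)
    (hx : (n : ℤ) ∣ (r.x - r'.x : ℤ)) (hy : (n : ℤ) ∣ (r.y - r'.y : ℤ))
    (hz : (n : ℤ) ∣ (r.z - r'.z : ℤ)) : r'.Approx n X := by
  obtain ⟨c, h₁, h₂, h₃⟩ := h
  have key : ∀ {t u v : ℤ}, n ∣ t - c * u → n ∣ u - v → n ∣ t - c * v := by
    rintro t u v ⟨a, ha⟩ ⟨b, hb⟩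
    exact ⟨a + c * b, by linear_combination ha + c * hb⟩
  exact ⟨c, key h₁ hx, key h₂ hy, key h₃ hz⟩

lemma List.all_range_apply {n k : ℕ} {p : ℕ → Bool} (h : (List.range n).all p = true)
    (hk : k < n) : p k = true :=
  List.all_eq_true.1 h k (List.mem_range.2 hk)

/-- A chart: congruent parameters give congruent vectors. -/
def IsChart (f : ℕ → ℕ → NVec) : Prop :=
  ∀ (n : ℤ) (b c b' c' : ℕ), n ∣ (b - b' : ℤ) → n ∣ (c - c' : ℤ) →
    n ∣ ((f b c).x - (f b' c').x : ℤ) ∧ n ∣ ((f b c).y - (f b' c').y : ℤ) ∧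
      n ∣ ((f b c).z - (f b' c').z : ℤ)

lemma isChart_chart₁ : IsChart chart₁ := by
  intro n b c b' c' hb hc
  simpa [chart₁] using ⟨hb, hc⟩

lemma isChart_chart₂ : IsChart chart₂ := by
  intro n b c b' c' hb hc
  simpa [chart₂] using ⟨hb, hc⟩

lemma IsChart.approx {f : ℕ → ℕ → NVec} (hf : IsChart f) {n n' : ℤ} {b c b' c' : ℕ} {X : IVec}
    (h : (f b c).Approx n X) (hn : n' ∣ n) (hb : n' ∣ (b - b' : ℤ)) (hc : n' ∣ (c - c' : ℤ)) :
    (f b' c').Approx n' X := by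
  obtain ⟨h₁, h₂, h₃⟩ := hf n' b c b' c' hb hc
  exact (h.mono hn).of_congr h₁ h₂ h₃

lemma NVec.Approx.dvd_dot_self {n : ℤ} {r : NVec} {X : IVec} (h : r.Approx n X) :
    ∃ c : ℤ, n ∣ X.dot X - c ^ 2 * (r.dot r : ℕ) := by
  obtain ⟨c, ⟨a₁, h₁⟩, ⟨a₂, h₂⟩, ⟨a₃, h₃⟩⟩ := h
  refine ⟨c, a₁ * (X.x + c * r.x) + a₂ * (X.y + c * r.y) + a₃ * (X.z + c * r.z), ?_⟩
  simp only [IVec.dot, NVec.dot]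
  push_cast
  linear_combination (X.x + c * r.x) * h₁ + (X.y + c * r.y) * h₂ + (X.z + c * r.z) * h₃

lemma NVec.Approx.dot_mod_three {r : NVec} {X : IVec} (h : r.Approx 3 X)
    (hX : X.dot X % 3 = 2) : r.dot r % 3 = 2 := by
  obtain ⟨c, hc⟩ := h.dvd_dot_self
  have hc' : c ^ 2 % 3 = 0 ∨ c ^ 2 % 3 = 1 := by
    have : c % 3 = 0 ∨ c % 3 = 1 ∨ c % 3 = 2 := by lia
    rcases this with h | h | h <;> simp [pow_two, Int.mul_emod, h]
  have e := Int.emod_emod_of_dvd (c ^ 2 * (r.dot r : ℕ)) (dvd_refl 3)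
  have h₁ : (c ^ 2 * (r.dot r : ℕ)) % 3 = 2 := by lia
  rw [Int.mul_emod] at h₁
  rcases hc' with h' | h' <;> rw [h'] at h₁ <;> lia

lemma NVec.Approx.dot_mod_seven {r : NVec} {X : IVec} (h : r.Approx 7 X)
    (hX : X.dot X % 7 = 6) : r.dot r % 7 = 3 ∨ r.dot r % 7 = 5 ∨ r.dot r % 7 = 6 := by
  obtain ⟨c, hc⟩ := h.dvd_dot_self
  have hc' : c ^ 2 % 7 = 0 ∨ c ^ 2 % 7 = 1 ∨ c ^ 2 % 7 = 2 ∨ c ^ 2 % 7 = 4 := by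
    have : c % 7 = 0 ∨ c % 7 = 1 ∨ c % 7 = 2 ∨ c % 7 = 3 ∨ c % 7 = 4 ∨ c % 7 = 5 ∨ c % 7 = 6 := by
      lia
    rcases this with h | h | h | h | h | h | h <;> simp [pow_two, Int.mul_emod, h]
  have h₁ : (c ^ 2 * (r.dot r : ℕ)) % 7 = 6 := by lia
  rw [Int.mul_emod] at h₁
  rcases hc' with h' | h' | h' | h' <;> rw [h'] at h₁ <;> omega

lemma testAxes_or_repDiagonal {m : ℤ} {f g : ℕ → ℕ → NVec} {B D b c d e : ℕ} {X : IVec}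
    (hm₃ : m % 3 = 2) (hm₇ : m % 7 = 6) (hX : X.Admissible m) (hf : IsChart f) (hg : IsChart g)
    (hB : b % 3 < B) (hD : d % 7 < D) (hb : b < 27) (hc : c < 27) (hd : d < 49) (he : e < 49)
    (hr : (f b c).Approx 27 X) (hs : (g d e).Approx 49 X) (h : checkCharts f g B D = true) :
    testAxes (f b c) (g d e) = true ∨ RepDiagonal m := by
  have hr₁ : (f (b % 3) (c % 3)).Approx 3 X := hf.approx hr (by decide) (by lia) (by lia)
  have hr₂ : (f (b % 3 + 3 * (b / 3 % 3)) (c % 3 + 3 * (c / 3 % 3))).Approx 9 X :=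
    hf.approx hr (by decide) (by lia) (by lia)
  have hr₃ : b % 3 + 3 * (b / 3 % 3) + 9 * (b / 9) = b ∧
      c % 3 + 3 * (c / 3 % 3) + 9 * (c / 9) = c := by lia
  have hs₁ : (g (d % 7) (e % 7)).Approx 7 X := hg.approx hs (by decide) (by lia) (by lia)
  have hs₂ : d % 7 + 7 * (d / 7) = d ∧ e % 7 + 7 * (e / 7) = e := by lia
  have t := soundTest_testDiagonal m
  have t₃ := t.descend₃ (by decide) (by decide) (by exact ⟨-2, 1, by norm_num⟩)
  have t₇ := t.descend₇ (by decide) (by decide) (by exact ⟨1, -2, by norm_num⟩)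
  have t₃₇ := t₇.descend₃ (by decide) (by decide) (by exact ⟨-16, 1, by norm_num⟩)
  have t₃₃ := t₃.descend₃ (by decide) (by decide) (by exact ⟨-2, 1, by norm_num⟩)
  have t₃₃₇ := t₃₇.descend₃ (by decide) (by decide) (by exact ⟨-16, 1, by norm_num⟩)
  norm_num at t₃ t₇ t₃₇ t₃₃ t₃₃₇
  have h := List.all_range_apply h hB
  have h := List.all_range_apply h (Nat.mod_lt c three_pos)
  rw [NVec.evalThen_eq, hr₁.dot_mod_three (by rw [hX.sq]; exact hm₃)] at h
  simp only [beq_self_eq_true, Bool.not_true, Bool.false_or] at h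
  have h := List.all_range_apply h hD
  have h := List.all_range_apply h (Nat.mod_lt e (by norm_num : 7 > 0))
  rw [NVec.evalThen_eq] at h
  have hq := hs₁.dot_mod_seven (by rw [hX.sq]; exact hm₇)
  simp only [Bool.or_eq_true, Bool.not_eq_true', Bool.or_eq_false_iff,
    beq_eq_false_iff_ne] at h
  rcases h with h | h | h
  · tauto
  · exact Or.inr (t _ _ X hX hr₁ hs₁ h)
  have h := List.all_range_apply h (Nat.mod_lt (b / 3) three_pos)
  have h := List.all_range_apply h (Nat.mod_lt (c / 3) three_pos)
  rw [NVec.evalThen_eq, Bool.or_eq_true] at h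
  rcases h with h | h
  · exact Or.inr (t₃ _ _ X hX hr₂ hs₁ h)
  have h := List.all_range_apply h (k := d / 7) (by lia)
  have h := List.all_range_apply h (k := e / 7) (by lia)
  rw [NVec.evalThen_eq, hs₂.1, hs₂.2] at h
  simp only [Bool.or_eq_true] at h
  rcases h with h | h | h
  · exact Or.inr (t₇ _ _ X hX (hr₂.mono (by decide)) hs h)
  · exact Or.inr (t₃₇ _ _ X hX hr₂ hs h)
  have h := List.all_range_apply h (k := b / 9) (by lia)
  have h := List.all_range_apply h (k := c / 9) (by lia)
  rw [NVec.evalThen_eq, hr₃.1, hr₃.2] at h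
  simp only [Bool.or_eq_true] at h
  rcases h with h | h | h
  · exact Or.inr (t₃₃ _ _ X hX hr (hs.mono (by decide)) h)
  · exact Or.inr (t₃₃₇ _ _ X hX hr hs h)
  · exact Or.inl h

lemma exists_nat_dvd_sub {n : ℕ} (hn : 0 < n) {x : ℤ} (hx : IsCoprime x n) (y : ℤ) :
    ∃ b : ℕ, b < n ∧ (n : ℤ) ∣ y - x * b := by
  obtain ⟨u, v, huv⟩ := hx
  have hn' : (0 : ℤ) < n := by exact_mod_cast hn
  have h₀ := Int.emod_nonneg (u * y) hn'.ne'
  have h₁ := Int.emod_lt_of_pos (u * y) hn'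
  have h₂ := Int.emod_add_mul_ediv (u * y) n
  refine ⟨(u * y % n).toNat, by lia, v * y + x * (u * y / n), ?_⟩
  rw [Int.toNat_of_nonneg h₀]
  linear_combination -y * huv - x * h₂

lemma exists_approx_chart₁ {n : ℕ} (hn : 0 < n) {X : IVec} (hX : IsCoprime X.x n) :
    ∃ b c, b < n ∧ c < n ∧ (chart₁ b c).Approx n X := by
  obtain ⟨b, hb, hb'⟩ := exists_nat_dvd_sub hn hX X.y
  obtain ⟨c, hc, hc'⟩ := exists_nat_dvd_sub hn hX X.z
  exact ⟨b, c, hb, hc, X.x, by simp [chart₁], hb', hc'⟩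

lemma exists_approx_chart₂ {n p : ℕ} (hn : 0 < n) (hp : p ∣ n) {X : IVec} (hX : IsCoprime X.y n)
    (hx : (p : ℤ) ∣ X.x) : ∃ b c, p ∣ b ∧ b < n ∧ c < n ∧ (chart₂ b c).Approx n X := by
  obtain ⟨b, hb, hb'⟩ := exists_nat_dvd_sub hn hX X.x
  obtain ⟨c, hc, hc'⟩ := exists_nat_dvd_sub hn hX X.z
  have hpn : (p : ℤ) ∣ n := by exact_mod_cast hp
  have hpb : (p : ℤ) ∣ X.y * b := (dvd_sub_right hx).1 (hpn.trans hb')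
  exact ⟨b, c, by exact_mod_cast (hX.symm.of_isCoprime_of_dvd_left hpn).dvd_of_dvd_mul_left hpb,
    hb, hc, X.y, hb', by simp [chart₂], hc'⟩

lemma isCoprime_pow_of_not_dvd {p : ℕ} (hp : p.Prime) {x : ℤ} (h : ¬(p : ℤ) ∣ x) (k : ℕ) :
    IsCoprime x ((p ^ k : ℕ) : ℤ) := by
  push_cast
  exact (((Nat.prime_iff_prime_int.1 hp).coprime_iff_not_dvd.2 h).symm).pow_right

lemma not_three_dvd_y {m : ℤ} (hm : m % 3 = 2) {X : IVec} (hX : X.dot X = m) (hx : 3 ∣ X.x) :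
    ¬3 ∣ X.y := by
  rintro ⟨b, hb⟩
  obtain ⟨a, ha⟩ := hx
  rw [IVec.dot, ha, hb] at hX
  have h : X.z * X.z % 3 = 2 := by lia
  have : X.z % 3 = 0 ∨ X.z % 3 = 1 ∨ X.z % 3 = 2 := by lia
  rcases this with h' | h' | h' <;> simp [Int.mul_emod, h'] at h

lemma not_seven_dvd_y {m : ℤ} (hm : m % 7 = 6) {X : IVec} (hX : X.dot X = m) (hx : 7 ∣ X.x) :
    ¬7 ∣ X.y := by
  rintro ⟨b, hb⟩
  obtain ⟨a, ha⟩ := hx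
  rw [IVec.dot, ha, hb] at hX
  have h : X.z * X.z % 7 = 6 := by lia
  have : X.z % 7 = 0 ∨ X.z % 7 = 1 ∨ X.z % 7 = 2 ∨ X.z % 7 = 3 ∨ X.z % 7 = 4 ∨ X.z % 7 = 5 ∨
    X.z % 7 = 6 := by lia
  rcases this with h' | h' | h' | h' | h' | h' | h' <;> simp [Int.mul_emod, h'] at h

/-- The vector `X` is proportional to the axis `w` modulo `1323`. -/
def Near (w : NVec) (X : IVec) : Prop := (X.cross w.centered).DvdBy 1323

lemma NVec.Approx.dvdBy_cross {n : ℕ} {r w : NVec} {X : IVec} (hn : (n : ℤ) ∣ 1323)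
    (h : r.Approx n X) (hw : r.proportional n w = true) : (X.cross w.centered).DvdBy n := by
  simp only [NVec.proportional, Bool.and_eq_true, beq_iff_eq] at hw
  obtain ⟨hw₁, hw₂, hw₃⟩ := hw
  obtain ⟨c, ⟨a₁, h₁⟩, ⟨a₂, h₂⟩, ⟨a₃, h₃⟩⟩ := h
  obtain ⟨b₁, e₁⟩ := hn.trans (dvd_centered_sub w.x)
  obtain ⟨b₂, e₂⟩ := hn.trans (dvd_centered_sub w.y)
  obtain ⟨b₃, e₃⟩ := hn.trans (dvd_centered_sub w.z)
  obtain ⟨d₁, g₁⟩ := (Nat.modEq_iff_dvd (n := n)).1 hw₁.symm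
  obtain ⟨d₂, g₂⟩ := (Nat.modEq_iff_dvd (n := n)).1 hw₂.symm
  obtain ⟨d₃, g₃⟩ := (Nat.modEq_iff_dvd (n := n)).1 hw₃.symm
  push_cast at g₁ g₂ g₃
  simp only [IVec.DvdBy, IVec.cross, NVec.centered]
  refine ⟨⟨X.y * b₃ - X.z * b₂ + a₂ * w.z - a₃ * w.y + c * d₂, ?_⟩,
    ⟨X.z * b₁ - X.x * b₃ + a₃ * w.x - a₁ * w.z + c * d₃, ?_⟩,
    ⟨X.x * b₂ - X.y * b₁ + a₁ * w.y - a₂ * w.x + c * d₁, ?_⟩⟩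
  · linear_combination X.y * e₃ - X.z * e₂ + w.z * h₂ - w.y * h₃ + c * g₂
  · linear_combination X.z * e₁ - X.x * e₃ + w.x * h₃ - w.z * h₁ + c * g₃
  · linear_combination X.x * e₂ - X.y * e₁ + w.y * h₁ - w.x * h₂ + c * g₁

lemma exists_near_of_testAxes {r s : NVec} {X : IVec} (hr : r.Approx 27 X) (hs : s.Approx 49 X)
    (h : testAxes r s = true) : ∃ w ∈ axes, Near w X := by
  obtain ⟨w, hw, h⟩ := List.any_eq_true.1 h
  rw [Bool.and_eq_true] at h
  obtain ⟨x₁, y₁, z₁⟩ := NVec.Approx.dvdBy_cross (n := 27) (by decide) hr h.1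
  obtain ⟨x₂, y₂, z₂⟩ := NVec.Approx.dvdBy_cross (n := 49) (by decide) hs h.2
  exact ⟨w, hw, by lia, by lia, by lia⟩

lemma IVec.Admissible.exists_near {m : ℤ} (hm : m % 168 = 41) (h : ¬RepDiagonal m) {X : IVec}
    (hX : X.Admissible m) : ∃ w ∈ axes, Near w X := by
  have hm₃ : m % 3 = 2 := by lia
  have hm₇ : m % 7 = 6 := by lia
  obtain ⟨f, B, b, c, hf, hB, hb, hc, hr, hfB⟩ : ∃ f B b c, IsChart f ∧ b % 3 < B ∧ b < 27 ∧
      c < 27 ∧ (f b c).Approx 27 X ∧ (f = chart₁ ∧ B = 3 ∨ f = chart₂ ∧ B = 1) := by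
    by_cases hx : 3 ∣ X.x
    · obtain ⟨b, c, hb, hb', hc, hr⟩ := exists_approx_chart₂ (n := 27) (p := 3) (by lia) (by lia)
        (isCoprime_pow_of_not_dvd Nat.prime_three (not_three_dvd_y hm₃ hX.sq hx) 3) hx
      exact ⟨_, 1, b, c, isChart_chart₂, by lia, hb', hc, hr, by simp⟩
    · obtain ⟨b, c, hb, hc, hr⟩ := exists_approx_chart₁ (n := 27) (by lia)
        (isCoprime_pow_of_not_dvd Nat.prime_three hx 3)
      exact ⟨_, 3, b, c, isChart_chart₁, by lia, hb, hc, hr, by simp⟩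
  obtain ⟨g, D, d, e, hg, hD, hd, he, hs, hgD⟩ : ∃ g D d e, IsChart g ∧ d % 7 < D ∧ d < 49 ∧
      e < 49 ∧ (g d e).Approx 49 X ∧ (g = chart₁ ∧ D = 7 ∨ g = chart₂ ∧ D = 1) := by
    by_cases hx : 7 ∣ X.x
    · obtain ⟨b, c, hb, hb', hc, hr⟩ := exists_approx_chart₂ (n := 49) (p := 7) (by lia) (by lia)
        (isCoprime_pow_of_not_dvd Nat.prime_seven (not_seven_dvd_y hm₇ hX.sq hx) 2) hx
      exact ⟨_, 1, b, c, isChart_chart₂, by lia, hb', hc, hr, by simp⟩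
    · obtain ⟨b, c, hb, hc, hr⟩ := exists_approx_chart₁ (n := 49) (by lia)
        (isCoprime_pow_of_not_dvd Nat.prime_seven hx 2)
      exact ⟨_, 7, b, c, isChart_chart₁, by lia, hb, hc, hr, by simp⟩
  have hcheck : checkCharts f g B D = true := by
    obtain ⟨rfl, rfl⟩ | ⟨rfl, rfl⟩ := hfB <;> obtain ⟨rfl, rfl⟩ | ⟨rfl, rfl⟩ := hgD
    exacts [checkCharts₁₁, checkCharts₁₂, checkCharts₂₁, checkCharts₂₂]
  exact exists_near_of_testAxes hr hs
    ((testAxes_or_repDiagonal hm₃ hm₇ hX hf hg hB hD hb hc hd he hr hs hcheck).resolve_right h)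

lemma dvdBy_div_of_mem_axes : ∀ w ∈ axes, ∀ M ∈ rotations₃, (M.act w.centered).DvdBy 3 →
    ∀ w' ∈ axes, (((M.act w.centered).div 3).cross w'.centered).DvdBy 441 → ∃ e ∈ [1, -1],
      (M.act w.centered).x = 3 * (e * w'.centered.x) ∧
      (M.act w.centered).y = 3 * (e * w'.centered.y) ∧
      (M.act w.centered).z = 3 * (e * w'.centered.z) := by
  decide +kernel

lemma axes_dvd_three : ∀ w ∈ axes, ∀ a ∈ [0, 1, 2], ∀ b ∈ [0, 1, 2], ∀ c ∈ [0, 1, 2],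
    (∀ M ∈ rotations₃, (M.act w.centered).DvdBy 3 → (M.act ⟨a, b, c⟩).DvdBy 3) →
    3 ∣ w.centered.dot ⟨a, b, c⟩ → a = 0 ∧ b = 0 ∧ c = 0 := by
  decide +kernel

lemma axes_norm : ∀ w ∈ axes, w.centered.dot w.centered ∈ [5, 17, 26, 125] := by
  decide +kernel

lemma cross_act {M : NMat} (hM : M ∈ rotations₃) (X Y : IVec) :
    ((M.act X).cross (M.act Y)).x = 3 * (M.act (X.cross Y)).x ∧
    ((M.act X).cross (M.act Y)).y = 3 * (M.act (X.cross Y)).y ∧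
    ((M.act X).cross (M.act Y)).z = 3 * (M.act (X.cross Y)).z := by
  simp only [rotations₃, List.mem_cons, List.not_mem_nil, or_false] at hM
  rcases hM with rfl | rfl | rfl | rfl <;>
    simp only [NMat.act, IVec.dot, IVec.cross, NVec.centered, centered] <;> norm_num <;>
    refine ⟨?_, ?_, ?_⟩ <;> ring

lemma IVec.DvdBy.cross_trans {n : ℤ} {X Y Z : IVec} (h : (X.cross Y).DvdBy n)
    (h' : (X.cross Z).DvdBy n) (hn : IsCoprime n (X.dot X)) : (Y.cross Z).DvdBy n := by
  obtain ⟨⟨a₁, h₁⟩, ⟨a₂, h₂⟩, ⟨a₃, h₃⟩⟩ := h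
  obtain ⟨⟨b₁, e₁⟩, ⟨b₂, e₂⟩, ⟨b₃, e₃⟩⟩ := h'
  refine ⟨hn.dvd_of_dvd_mul_left
      ⟨X.dot Y * b₁ - X.dot Z * a₁ + X.x * (a₁ * Z.x + a₂ * Z.y + a₃ * Z.z), ?_⟩,
    hn.dvd_of_dvd_mul_left
      ⟨X.dot Y * b₂ - X.dot Z * a₂ + X.y * (a₁ * Z.x + a₂ * Z.y + a₃ * Z.z), ?_⟩,
    hn.dvd_of_dvd_mul_left
      ⟨X.dot Y * b₃ - X.dot Z * a₃ + X.z * (a₁ * Z.x + a₂ * Z.y + a₃ * Z.z), ?_⟩⟩ <;>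
    simp only [IVec.cross, IVec.dot] at *
  · linear_combination (X.x * Y.x + X.y * Y.y + X.z * Y.z) * e₁
      - (X.x * Z.x + X.y * Z.y + X.z * Z.z) * h₁ + X.x * (Z.x * h₁ + Z.y * h₂ + Z.z * h₃)
  · linear_combination (X.x * Y.x + X.y * Y.y + X.z * Y.z) * e₂
      - (X.x * Z.x + X.y * Z.y + X.z * Z.z) * h₂ + X.y * (Z.x * h₁ + Z.y * h₂ + Z.z * h₃)
  · linear_combination (X.x * Y.x + X.y * Y.y + X.z * Y.z) * e₃
      - (X.x * Z.x + X.y * Z.y + X.z * Z.z) * h₃ + X.z * (Z.x * h₁ + Z.y * h₂ + Z.z * h₃)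

lemma dvdBy_act {n : ℤ} {X : IVec} (M : NMat) (h : X.DvdBy n) : (M.act X).DvdBy n := by
  obtain ⟨h₁, h₂, h₃⟩ := h
  refine ⟨?_, ?_, ?_⟩ <;>
    exact dvd_add (dvd_add (h₁.mul_left _) (h₂.mul_left _)) (h₃.mul_left _)

lemma dvdBy_act_of_dvdBy_cross {n : ℤ} {X W : IVec} {M : NMat} (h : (X.cross W).DvdBy n)
    (hW : (M.act W).DvdBy n) (hn : IsCoprime n (W.dot W)) : (M.act X).DvdBy n := by
  have h' : ∀ u : NVec, n ∣ u.centered.dot W → n ∣ u.centered.dot X := by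
    intro u hu
    refine hn.dvd_of_dvd_mul_left ?_
    obtain ⟨⟨a₁, h₁⟩, ⟨a₂, h₂⟩, ⟨a₃, h₃⟩⟩ := h
    obtain ⟨k, hk⟩ := hu
    set v := u.centered
    simp only [IVec.cross, IVec.dot] at *
    refine ⟨(X.x * W.x + X.y * W.y + X.z * W.z) * k + (v.x * (W.y * a₃ - W.z * a₂)
      + v.y * (W.z * a₁ - W.x * a₃) + v.z * (W.x * a₂ - W.y * a₁)), ?_⟩
    linear_combination (X.x * W.x + X.y * W.y + X.z * W.z) * hk + v.x * (W.y * h₃ - W.z * h₂)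
      + v.y * (W.z * h₁ - W.x * h₃) + v.z * (W.x * h₂ - W.y * h₁)
  exact ⟨h' _ hW.1, h' _ hW.2.1, h' _ hW.2.2⟩

lemma IVec.DvdBy.eq_mul_div {n : ℤ} {X : IVec} (h : X.DvdBy n) :
    X.x = n * (X.div n).x ∧ X.y = n * (X.div n).y ∧ X.z = n * (X.div n).z :=
  ⟨(Int.mul_ediv_cancel' h.1).symm, (Int.mul_ediv_cancel' h.2.1).symm,
    (Int.mul_ediv_cancel' h.2.2).symm⟩

lemma isCoprime_three_axes_norm {w : NVec} (hw : w ∈ axes) :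
    IsCoprime 3 (w.centered.dot w.centered) := by
  have h := axes_norm w hw
  simp only [List.mem_cons, List.not_mem_nil, or_false] at h
  rcases h with h | h | h | h <;> rw [h]
  · exact ⟨2, -1, by norm_num⟩
  · exact ⟨6, -1, by norm_num⟩
  · exact ⟨9, -1, by norm_num⟩
  · exact ⟨42, -1, by norm_num⟩

lemma dvdBy_act_cross {m : ℤ} (hm : m % 168 = 41) (hrep : ¬RepDiagonal m) {n : ℤ}
    (ih : ∀ X : IVec, X.Admissible m → ∀ w ∈ axes, Near w X → (X.cross w.centered).DvdBy n)
    {X : IVec} (hX : X.Admissible m) {w : NVec} (hw : w ∈ axes) (h : Near w X) {M : NMat}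
    (hM : M ∈ rotations₃) (hMw : (M.act w.centered).DvdBy 3) :
    (M.act (X.cross w.centered)).DvdBy (3 * n) := by
  have h₃ : (X.cross w.centered).DvdBy 3 :=
    ⟨(by decide : (3 : ℤ) ∣ 1323).trans h.1, (by decide : (3 : ℤ) ∣ 1323).trans h.2.1,
      (by decide : (3 : ℤ) ∣ 1323).trans h.2.2⟩
  obtain ⟨x₁, x₂, x₃⟩ :=
    (dvdBy_act_of_dvdBy_cross h₃ hMw (isCoprime_three_axes_norm hw)).eq_mul_div
  obtain ⟨u₁, u₂, u₃⟩ := hMw.eq_mul_div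
  have hadm := (isScaledRotation_three hM).admissible (by decide) hX x₁ x₂ x₃
  obtain ⟨w', hw', hnear⟩ := hadm.exists_near hm hrep
  obtain ⟨c₁, c₂, c₃⟩ := cross_act hM X w.centered
  have hdvd := dvdBy_act M h
  have hfact := dvdBy_div_of_mem_axes w hw M hM hMw w' hw'
  set X' := (M.act X).div 3
  set U := (M.act w.centered).div 3
  have d₁ : (M.act (X.cross w.centered)).x = 3 * (X'.cross U).x := by
    simp only [IVec.cross, x₁, x₂, x₃, u₁, u₂, u₃] at c₁ ⊢
    linarith
  have d₂ : (M.act (X.cross w.centered)).y = 3 * (X'.cross U).y := by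
    simp only [IVec.cross, x₁, x₂, x₃, u₁, u₂, u₃] at c₂ ⊢
    linarith
  have d₃ : (M.act (X.cross w.centered)).z = 3 * (X'.cross U).z := by
    simp only [IVec.cross, x₁, x₂, x₃, u₁, u₂, u₃] at c₃ ⊢
    linarith
  have hU : (X'.cross U).DvdBy 441 := by
    rw [IVec.DvdBy, d₁, d₂, d₃] at hdvd
    exact ⟨by lia, by lia, by lia⟩
  have hw'' : (X'.cross w'.centered).DvdBy 441 :=
    ⟨(by decide : (441 : ℤ) ∣ 1323).trans hnear.1, (by decide : (441 : ℤ) ∣ 1323).trans hnear.2.1,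
      (by decide : (441 : ℤ) ∣ 1323).trans hnear.2.2⟩
  have hcop : IsCoprime 441 (X'.dot X') := by
    rw [hadm.sq, show (441 : ℤ) = 21 ^ 2 by norm_num]
    exact IsCoprime.pow_left ⟨2 + 8 * (m / 168), -1, by lia⟩
  obtain ⟨e, -, e₁, e₂, e₃⟩ := hfact (hU.cross_trans hw'' hcop)
  obtain ⟨k₁, k₂, k₃⟩ := ih X' hadm w' hw' hnear
  have v₁ : U.x = e * w'.centered.x := by lia
  have v₂ : U.y = e * w'.centered.y := by lia
  have v₃ : U.z = e * w'.centered.z := by lia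
  rw [IVec.DvdBy, d₁, d₂, d₃]
  refine ⟨mul_dvd_mul_left 3 ?_, mul_dvd_mul_left 3 ?_, mul_dvd_mul_left 3 ?_⟩
  · convert k₁.mul_left e using 1
    simp only [IVec.cross, v₂, v₃]; ring
  · convert k₂.mul_left e using 1
    simp only [IVec.cross, v₁, v₃]; ring
  · convert k₃.mul_left e using 1
    simp only [IVec.cross, v₁, v₂]; ring

lemma dvdBy_three_of_dvdBy_act {w : NVec} (hw : w ∈ axes) {Y : IVec}
    (h : ∀ M ∈ rotations₃, (M.act w.centered).DvdBy 3 → (M.act Y).DvdBy 3)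
    (hY : 3 ∣ w.centered.dot Y) : Y.DvdBy 3 := by
  have hmem : ∀ t : ℤ, t % 3 ∈ [0, 1, 2] := by
    intro t
    simp only [List.mem_cons, List.not_mem_nil, or_false]
    lia
  have hdot : ∀ u : IVec, 3 ∣ u.dot Y → 3 ∣ u.dot ⟨Y.x % 3, Y.y % 3, Y.z % 3⟩ := by
    rintro u ⟨k, hk⟩
    refine ⟨k - u.x * (Y.x / 3) - u.y * (Y.y / 3) - u.z * (Y.z / 3), ?_⟩
    simp only [IVec.dot] at *
    linear_combination hk + u.x * Int.emod_add_mul_ediv Y.x 3 + u.y * Int.emod_add_mul_ediv Y.y 3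
      + u.z * Int.emod_add_mul_ediv Y.z 3
  obtain ⟨h₁, h₂, h₃⟩ := axes_dvd_three w hw _ (hmem Y.x) _ (hmem Y.y) _ (hmem Y.z)
    (fun M hM hMw => ⟨hdot _ (h M hM hMw).1, hdot _ (h M hM hMw).2.1, hdot _ (h M hM hMw).2.2⟩)
    (hdot _ hY)
  exact ⟨Int.dvd_of_emod_eq_zero h₁, Int.dvd_of_emod_eq_zero h₂, Int.dvd_of_emod_eq_zero h₃⟩

lemma Near.dvdBy_pow {m : ℤ} (hm : m % 168 = 41) (hrep : ¬RepDiagonal m) (i : ℕ) :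
    ∀ X : IVec, X.Admissible m → ∀ w ∈ axes, Near w X →
      (X.cross w.centered).DvdBy (3 ^ i) := by
  induction i with
  | zero => intro X _ w _ _; simp [IVec.DvdBy]
  | succ i ih =>
    intro X hX w hw h
    have hact := fun M hM hMw => dvdBy_act_cross hm hrep ih hX hw h (M := M) hM hMw
    obtain ⟨y₁, y₂, y₃⟩ := (ih X hX w hw h).eq_mul_div
    set Y := (X.cross w.centered).div (3 ^ i)
    have hpow : (3 : ℤ) ^ i ≠ 0 := by positivity
    have hdot : ∀ u : IVec, u.dot (X.cross w.centered) = 3 ^ i * u.dot Y := by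
      intro u
      rw [IVec.dot, y₁, y₂, y₃, IVec.dot]; ring
    have key : ∀ u : IVec, 3 * 3 ^ i ∣ u.dot (X.cross w.centered) → 3 ∣ u.dot Y := by
      intro u hu
      rw [hdot, mul_comm] at hu
      exact (mul_dvd_mul_iff_left hpow).1 hu
    have horth : w.centered.dot (X.cross w.centered) = 0 := by
      simp only [IVec.dot, IVec.cross]; ring
    have hY : Y.DvdBy 3 := by
      refine dvdBy_three_of_dvdBy_act hw (fun M hM hMw => ?_) (key _ (horth ▸ dvd_zero _))
      obtain ⟨a₁, a₂, a₃⟩ := hact M hM hMw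
      exact ⟨key _ a₁, key _ a₂, key _ a₃⟩
    rw [IVec.DvdBy, y₁, y₂, y₃, pow_succ]
    exact ⟨mul_dvd_mul_left _ hY.1, mul_dvd_mul_left _ hY.2.1, mul_dvd_mul_left _ hY.2.2⟩

lemma eq_zero_of_forall_pow_dvd {t : ℤ} (h : ∀ i : ℕ, (3 : ℤ) ^ i ∣ t) : t = 0 := by
  refine Int.eq_zero_of_abs_lt_dvd (h t.natAbs) ?_
  rw [Int.abs_eq_natAbs]
  exact_mod_cast Nat.lt_pow_self (by norm_num : 1 < 3)

lemma Near.cross_eq_zero {m : ℤ} (hm : m % 168 = 41) (hrep : ¬RepDiagonal m) {X : IVec}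
    (hX : X.Admissible m) {w : NVec} (hw : w ∈ axes) (h : Near w X) :
    (X.cross w.centered).x = 0 ∧ (X.cross w.centered).y = 0 ∧ (X.cross w.centered).z = 0 :=
  have H := fun i => Near.dvdBy_pow hm hrep i X hX w hw h
  ⟨eq_zero_of_forall_pow_dvd fun i => (H i).1, eq_zero_of_forall_pow_dvd fun i => (H i).2.1,
    eq_zero_of_forall_pow_dvd fun i => (H i).2.2⟩

lemma admissible_or_of_dot_eq {m : ℤ} {X : IVec} (hX : X.dot X = m) :
    X.Admissible m ∨ IVec.Admissible m ⟨X.x, X.z, X.y⟩ ∨ IVec.Admissible m ⟨X.y, X.x, X.z⟩ := by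
  have h : X.x * X.x + X.y * X.y + X.z * X.z = m := hX
  have : 2 ∣ X.x + X.z ∨ 2 ∣ X.x + X.y ∨ 2 ∣ X.y + X.z := by lia
  rcases this with h' | h' | h'
  · exact Or.inl ⟨hX, h'⟩
  · exact Or.inr (Or.inl ⟨by rw [← h, IVec.dot]; ring, h'⟩)
  · exact Or.inr (Or.inr ⟨by rw [← h, IVec.dot]; ring, h'⟩)

lemma dvdBy_of_cross_eq_zero {X W : IVec} (hx : (X.cross W).x = 0) (hy : (X.cross W).y = 0)
    (hz : (X.cross W).z = 0) (h₁ : X.dot X % 8 = 1) (hW : W.dot W ∈ [5, 17, 26, 125]) :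
    ∃ k : ℤ, X.dot X = 17 * k ^ 2 ∧ X.DvdBy k := by
  have hsq : (X.dot W) ^ 2 = W.dot W * X.dot X := by
    simp only [IVec.cross, IVec.dot] at *
    linear_combination -(X.y * W.z - X.z * W.y) * hx - (X.z * W.x - X.x * W.z) * hy
      - (X.x * W.y - X.y * W.x) * hz
  have e₁ : W.dot W * X.x = X.dot W * W.x := by
    simp only [IVec.cross, IVec.dot] at *
    linear_combination W.y * hz - W.z * hy
  have e₂ : W.dot W * X.y = X.dot W * W.y := by
    simp only [IVec.cross, IVec.dot] at *
    linear_combination W.z * hx - W.x * hz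
  have e₃ : W.dot W * X.z = X.dot W * W.z := by
    simp only [IVec.cross, IVec.dot] at *
    linear_combination W.x * hy - W.y * hx
  have hs : X.dot W ^ 2 % 8 = 0 ∨ X.dot W ^ 2 % 8 = 1 ∨ X.dot W ^ 2 % 8 = 4 := by
    have : X.dot W % 8 = 0 ∨ X.dot W % 8 = 1 ∨ X.dot W % 8 = 2 ∨ X.dot W % 8 = 3 ∨
      X.dot W % 8 = 4 ∨ X.dot W % 8 = 5 ∨ X.dot W % 8 = 6 ∨ X.dot W % 8 = 7 := by lia
    rcases this with h | h | h | h | h | h | h | h <;> simp [pow_two, Int.mul_emod, h]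
  have h17 : W.dot W = 17 := by
    simp only [List.mem_cons, List.not_mem_nil, or_false] at hW
    rcases hW with h | h | h | h <;> rw [h] at hsq <;> lia
  rw [h17] at hsq e₁ e₂ e₃
  obtain ⟨k, hk⟩ : 17 ∣ X.dot W :=
    (by norm_num : Prime (17 : ℤ)).dvd_of_dvd_pow (hsq ▸ dvd_mul_right _ _)
  rw [hk] at hsq e₁ e₂ e₃
  exact ⟨k, by linarith, ⟨W.x, by linarith⟩, ⟨W.y, by linarith⟩, ⟨W.z, by linarith⟩⟩

lemma IVec.Admissible.exists_dvdBy {m : ℤ} (hm : m % 168 = 41) (hrep : ¬RepDiagonal m) {X : IVec}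
    (hX : X.Admissible m) : ∃ k : ℤ, m = 17 * k ^ 2 ∧ X.DvdBy k := by
  obtain ⟨w, hw, h⟩ := hX.exists_near hm hrep
  obtain ⟨h₁, h₂, h₃⟩ := h.cross_eq_zero hm hrep hX hw
  obtain ⟨k, hk, hk'⟩ :=
    dvdBy_of_cross_eq_zero h₁ h₂ h₃ (by rw [hX.sq]; lia) (axes_norm w hw)
  exact ⟨k, by rw [← hX.sq, hk], hk'⟩

lemma dvdBy_of_dot_eq {k : ℤ} (hm : 17 * k ^ 2 % 168 = 41) (hrep : ¬RepDiagonal (17 * k ^ 2))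
    {X : IVec} (hX : X.dot X = 17 * k ^ 2) : X.DvdBy k := by
  have key : ∀ {Y : IVec}, Y.Admissible (17 * k ^ 2) → Y.DvdBy k := by
    intro Y hY
    obtain ⟨l, hl, h₁, h₂, h₃⟩ := hY.exists_dvdBy hm hrep
    have hkl : k ∣ l := (Int.pow_dvd_pow_iff two_ne_zero).1 ⟨1, by linarith⟩
    exact ⟨hkl.trans h₁, hkl.trans h₂, hkl.trans h₃⟩
  rcases admissible_or_of_dot_eq hX with h | h | h
  · exact key h
  · exact ⟨(key h).1, (key h).2.2, (key h).2.1⟩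
  · exact ⟨(key h).2.1, (key h).1, (key h).2.2⟩

/-- The product of `q = a + b i + c j + d k`, the pure quaternion `v` and the conjugate of `q`. -/
def quatAct (a b c d : ℤ) (v : IVec) : IVec :=
  ⟨(a ^ 2 + b ^ 2 - c ^ 2 - d ^ 2) * v.x + 2 * (b * c - a * d) * v.y + 2 * (b * d + a * c) * v.z,
    2 * (b * c + a * d) * v.x + (a ^ 2 - b ^ 2 + c ^ 2 - d ^ 2) * v.y + 2 * (c * d - a * b) * v.z,
    2 * (b * d - a * c) * v.x + 2 * (c * d + a * b) * v.y + (a ^ 2 - b ^ 2 - c ^ 2 + d ^ 2) * v.z⟩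

lemma dot_quatAct (a b c d : ℤ) (v : IVec) : (quatAct a b c d v).dot (quatAct a b c d v)
    = (a ^ 2 + b ^ 2 + c ^ 2 + d ^ 2) ^ 2 * v.dot v := by
  simp only [quatAct, IVec.dot]; ring

lemma repDiagonal_of_eq_mul_sq {k : ℤ} (hm : 17 * k ^ 2 % 168 = 41) :
    RepDiagonal (17 * k ^ 2) := by
  by_contra hrep
  have hk : k.natAbs ≠ 1 := by
    intro h
    rw [← Int.natAbs_sq, h] at hm
    norm_num at hm
  obtain ⟨p, hp, hpk⟩ := Nat.exists_prime_and_dvd hk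
  obtain ⟨a, b, c, d, hp'⟩ := Nat.sum_four_squares p
  have hsum : (a ^ 2 + b ^ 2 + c ^ 2 + d ^ 2 : ℤ) = p := by exact_mod_cast hp'
  obtain ⟨l, hl⟩ := Int.natCast_dvd.2 hpk
  have hl0 : l ≠ 0 := by
    rintro rfl
    simp [hl] at hm
  have hpZ : Prime (p : ℤ) := Nat.prime_iff_prime_int.1 hp
  have hdvd : ∀ v : IVec, v.dot v = 17 → (quatAct a b c d v).DvdBy p := by
    intro v hv
    have hn := dot_quatAct a b c d v
    set V := quatAct a b c d v
    have hV : IVec.dot ⟨l * V.x, l * V.y, l * V.z⟩ ⟨l * V.x, l * V.y, l * V.z⟩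
        = 17 * k ^ 2 := by
      rw [hsum, hv] at hn
      simp only [IVec.dot] at hn ⊢
      rw [hl]
      linear_combination l ^ 2 * hn
    obtain ⟨h₁, h₂, h₃⟩ := dvdBy_of_dot_eq hm hrep hV
    rw [hl, mul_comm] at h₁ h₂ h₃
    exact ⟨(mul_dvd_mul_iff_left hl0).1 h₁, (mul_dvd_mul_iff_left hl0).1 h₂,
      (mul_dvd_mul_iff_left hl0).1 h₃⟩
  have h2 : ¬(p : ℤ) ∣ 2 := by
    intro h
    obtain rfl : p = 2 := (Nat.prime_dvd_prime_iff_eq hp Nat.prime_two).1 (by exact_mod_cast h)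
    rw [hl] at hm
    push_cast at hm
    ring_nf at hm
    lia
  have of_two_mul : ∀ {t : ℤ}, (p : ℤ) ∣ 2 * t → (p : ℤ) ∣ t := fun h =>
    (hpZ.dvd_or_dvd h).resolve_left h2
  have d₁ := (hdvd ⟨1, 4, 0⟩ (by decide)).1
  have d₁' := (hdvd ⟨1, -4, 0⟩ (by decide)).1
  have d₂ := (hdvd ⟨0, 1, 4⟩ (by decide)).2.1
  have d₂' := (hdvd ⟨0, 1, -4⟩ (by decide)).2.1
  have d₃ := (hdvd ⟨4, 0, 1⟩ (by decide)).2.2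
  have d₃' := (hdvd ⟨-4, 0, 1⟩ (by decide)).2.2
  have s₁ := Int.dvd_add d₁ d₁'
  have s₂ := Int.dvd_add d₂ d₂'
  have s₃ := Int.dvd_add d₃ d₃'
  simp only [quatAct] at s₁ s₂ s₃
  have q₁ : (p : ℤ) ∣ a ^ 2 + b ^ 2 - c ^ 2 - d ^ 2 := of_two_mul (by convert s₁ using 1; ring)
  have q₂ : (p : ℤ) ∣ a ^ 2 - b ^ 2 + c ^ 2 - d ^ 2 := of_two_mul (by convert s₂ using 1; ring)
  have q₃ : (p : ℤ) ∣ a ^ 2 - b ^ 2 - c ^ 2 + d ^ 2 := of_two_mul (by convert s₃ using 1; ring)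
  have q₀ : (p : ℤ) ∣ a ^ 2 + b ^ 2 + c ^ 2 + d ^ 2 := dvd_of_eq hsum.symm
  have of_four_mul_sq : ∀ {t : ℕ}, (p : ℤ) ∣ 2 * (2 * t ^ 2) → p ^ 2 ∣ t ^ 2 := fun h =>
    pow_dvd_pow_of_dvd (by exact_mod_cast hpZ.dvd_of_dvd_pow (of_two_mul (of_two_mul h))) 2
  have ha := of_four_mul_sq (t := a)
    (by convert Int.dvd_add (Int.dvd_add q₀ q₁) (Int.dvd_add q₂ q₃) using 1; ring)
  have hb := of_four_mul_sq (t := b)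
    (by convert Int.dvd_sub (Int.dvd_add q₀ q₁) (Int.dvd_add q₂ q₃) using 1; ring)
  have hc := of_four_mul_sq (t := c)
    (by convert Int.dvd_sub (Int.dvd_add q₀ q₂) (Int.dvd_add q₁ q₃) using 1; ring)
  have hd := of_four_mul_sq (t := d)
    (by convert Int.dvd_sub (Int.dvd_add q₀ q₃) (Int.dvd_add q₁ q₂) using 1; ring)
  have hpp : p ^ 2 ∣ p := by
    nth_rewrite 2 [← hp']
    exact dvd_add (dvd_add (dvd_add ha hb) hc) hd
  have h := Nat.le_of_dvd hp.pos hpp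
  have h₁ := hp.two_le
  nlinarith

lemma repDiagonal_of_mod {m : ℕ} (hm : m % 168 = 41) : RepDiagonal m := by
  by_contra hrep
  obtain ⟨x, y, z, h⟩ := sum_three_squares_of_mod_eight_eq_one m (by lia)
  have key : ∀ {X : IVec}, ¬X.Admissible m := by
    intro X hX
    obtain ⟨k, hk, -⟩ := hX.exists_dvdBy (by lia) hrep
    exact hrep (hk ▸ repDiagonal_of_eq_mul_sq (by lia))
  have hX : IVec.dot ⟨x, y, z⟩ ⟨x, y, z⟩ = m := by
    rw [← h, IVec.dot]; ring
  rcases admissible_or_of_dot_eq hX with h | h | h <;> exact key h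

lemma exists_eq_or_neg_eq {q : ℤ} {t : ℤ} (h : q ∣ t - 1 ∨ q ∣ t + 1) :
    ∃ x : ℤ, (q * x + 1) ^ 2 = t ^ 2 := by
  obtain ⟨k, hk⟩ | ⟨k, hk⟩ := h
  · exact ⟨k, by rw [← hk]; ring⟩
  · exact ⟨-k, by rw [mul_neg, ← hk]; ring⟩

/-- For every non negative integer `n`, the equation
`21(4x+1)² + 14(6y+1)² + 6(14z+1)² = 168n + 41` has an integer solution `x, y, z`. -/
theorem rep_168n_41 (n : ℤ) (hn : 0 ≤ n) :
    ∃ x y z : ℤ,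
      21 * (4 * x + 1) ^ 2 + 14 * (6 * y + 1) ^ 2 + 6 * (14 * z + 1) ^ 2
        = 168 * n + 41 := by
  obtain ⟨a, b, c, h⟩ := repDiagonal_of_mod (m := 168 * n.toNat + 41) (by lia)
  push_cast at h
  rw [Int.toNat_of_nonneg hn] at h
  have h8 : ∀ t : ℤ, ¬2 ∣ t ∧ t ^ 2 % 8 = 1 ∨ 2 ∣ t ∧ (t ^ 2 % 8 = 0 ∨ t ^ 2 % 8 = 4) := by
    intro t
    have : t % 8 = 0 ∨ t % 8 = 1 ∨ t % 8 = 2 ∨ t % 8 = 3 ∨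
      t % 8 = 4 ∨ t % 8 = 5 ∨ t % 8 = 6 ∨ t % 8 = 7 := by lia
    have e := Int.mul_emod t t 8
    rw [← pow_two] at e
    rcases this with h | h | h | h | h | h | h | h <;> rw [h] at e <;> lia
  have ha := h8 a
  have hb := h8 b
  have hc := h8 c
  have hb₃ : ¬3 ∣ b := by
    rintro ⟨k, rfl⟩
    ring_nf at h
    lia
  have hc₇ : c ^ 2 % 7 = 1 := by lia
  have hc' : 7 ∣ c - 1 ∨ 7 ∣ c + 1 := by
    refine (by norm_num : Prime (7 : ℤ)).dvd_or_dvd ?_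
    rw [show (c - 1) * (c + 1) = c ^ 2 - 1 by ring]
    lia
  have hodd : ¬2 ∣ a ∧ ¬2 ∣ b ∧ ¬2 ∣ c := by lia
  obtain ⟨x, hx⟩ := exists_eq_or_neg_eq (q := 4) (t := a) (by lia)
  obtain ⟨y, hy⟩ := exists_eq_or_neg_eq (q := 6) (t := b) (by lia)
  obtain ⟨z, hz⟩ := exists_eq_or_neg_eq (q := 14) (t := c) (by lia)
  exact ⟨x, y, z, by rw [hx, hy, hz, h]⟩
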